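/- Let (X,Y) be jointly Gaussian random variables with positive variances and correlation coefficient ρ with 0 < ρ² < 1. Then for every ε ∈ [0, ρ²), the maximal-correlation Gaussian-filter rate-privacy function satisfies ĝ_ε(X;Y) = (1/2)·log( ρ² / (ρ² − ε) ); the supremum is attained at γ² = ((ρ²−ε)/ε)·var(Y). In particular ĝ_0(X;Y) = 0. -/

import Mathlib

open MeasureTheory ProbabilityTheory

noncomputable section

namespace GaussPrivacy

open Classical in
/-- Mutual information (in bits) between real-valued random variables `U` and `V` on
`(Ω, μ)`, defined as the Kullback–Leibler divergence of the joint law from the product of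
the marginal laws: it is `∫ log (dP_{UV}/d(P_U ⊗ P_V)) dP_{UV} / log 2` when
`P_{UV} ≪ P_U ⊗ P_V` with integrable log-likelihood ratio, and `⊤` otherwise. -/
def miE {Ω : Type*} [MeasurableSpace Ω] (μ : Measure Ω) (U V : Ω → ℝ) : EReal :=
  if (μ.map fun ω => (U ω, V ω)) ≪ (μ.map U).prod (μ.map V) ∧
      Integrable (llr (μ.map fun ω => (U ω, V ω)) ((μ.map U).prod (μ.map V)))
        (μ.map fun ω => (U ω, V ω))
  then (((∫ x, llr (μ.map fun ω => (U ω, V ω)) ((μ.map U).prod (μ.map V)) x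
      ∂(μ.map fun ω => (U ω, V ω))) / Real.log 2 : ℝ) : EReal)
  else ⊤

/-- Three independent standard Gaussian coordinates: the underlying probability space. -/
def μ3 : Measure (ℝ × ℝ × ℝ) :=
  (gaussianReal 0 1).prod ((gaussianReal 0 1).prod (gaussianReal 0 1))

/-- The private data `X`: a Gaussian with mean `mX` and standard deviation `sX`. -/
def Xg (mX sX : ℝ) : ℝ × ℝ × ℝ → ℝ := fun ω => mX + sX * ω.1

/-- The observable data `Y`, jointly Gaussian with `X`, with mean `mY`, standard deviation
`sY`, and correlation coefficient `ρ` with `X`. -/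
def Yg (mY sY ρ : ℝ) : ℝ × ℝ × ℝ → ℝ :=
  fun ω => mY + sY * (ρ * ω.1 + Real.sqrt (1 - ρ ^ 2) * ω.2.1)

/-- The output `Z_γ = Y + γ N` of the additive Gaussian privacy filter, where `N` is a
standard Gaussian independent of `(X, Y)`. -/
def Zg (mY sY ρ γ : ℝ) : ℝ × ℝ × ℝ → ℝ :=
  fun ω => Yg mY sY ρ ω + γ * ω.2.2

/-- The Hirschfeld–Gebelein–Rényi maximal correlation `ρ_m(U;V)` of real-valued random
variables `U, V` on `(Ω, μ)`: the supremum of `E[f(U)g(V)]` over measurable `f, g` with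
`E f(U) = E g(V) = 0` and `E f²(U) = E g²(V) = 1`. -/
def rhoMC {Ω : Type*} [MeasurableSpace Ω] (μ : Measure Ω) (U V : Ω → ℝ) : ℝ :=
  sSup { r : ℝ | ∃ f g : ℝ → ℝ, Measurable f ∧ Measurable g ∧
    (∫ ω, f (U ω) ∂μ) = 0 ∧ (∫ ω, g (V ω) ∂μ) = 0 ∧
    (∫ ω, (f (U ω)) ^ 2 ∂μ) = 1 ∧ (∫ ω, (g (V ω)) ^ 2 ∂μ) = 1 ∧
    r = ∫ ω, f (U ω) * g (V ω) ∂μ }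

/-- The maximal-correlation Gaussian-filter rate-privacy function
`ĝ_ε(X;Y) = sup { I(Y;Z_γ) : γ ≥ 0, ρ_m²(X;Z_γ) ≤ ε }` (in bits). -/
def ghG (mX mY sX sY ρ : ℝ) (ε : ℝ) : ℝ :=
  sSup { r : ℝ | ∃ γ : ℝ, 0 ≤ γ ∧
    (rhoMC μ3 (Xg mX sX) (Zg mY sY ρ γ)) ^ 2 ≤ ε ∧
    (r : EReal) = miE μ3 (Yg mY sY ρ) (Zg mY sY ρ γ) }

/-- The optimal noise level: `γ² = ((ρ²−ε)/ε)·var(Y)`. -/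
def γhat (sY ρ ε : ℝ) : ℝ := Real.sqrt (((ρ ^ 2 - ε) / ε) * sY ^ 2)


/-- The standard Gaussian measure on the real line. -/
abbrev gaussStd : Measure ℝ := gaussianReal 0 1

theorem integrable_and_integral_exp_quadratic {a : ℝ} (ha : a < 1 / 2) (b : ℝ) :
    Integrable (fun z => Real.exp (a * z ^ 2 + b * z)) gaussStd ∧
    ∫ z, Real.exp (a * z ^ 2 + b * z) ∂gaussStd
      = (√(1 - 2 * a))⁻¹ * Real.exp (b ^ 2 / (2 * (1 - 2 * a))) := by
  have hpos : 0 < 1 - 2 * a := by linarith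
  let v : NNReal := ⟨(1 - 2 * a)⁻¹, by positivity⟩
  have hv : v ≠ 0 := by
    intro h
    have := congrArg NNReal.toReal h
    exact hpos.ne' (inv_eq_zero.mp this)
  have hvc : (v : ℝ) = (1 - 2 * a)⁻¹ := rfl
  have key : ∀ z, gaussianPDFReal 0 1 z * Real.exp (a * z ^ 2 + b * z)
      = ((√(1 - 2 * a))⁻¹ * Real.exp (b ^ 2 / (2 * (1 - 2 * a)))) *
        gaussianPDFReal (b / (1 - 2 * a)) v z := by
    intro z
    simp only [gaussianPDFReal, hvc, NNReal.coe_one, mul_one, sub_zero]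
    have h1 : √(2 * Real.pi * (1 - 2 * a)⁻¹) = √(2 * Real.pi) * (√(1 - 2 * a))⁻¹ := by
      rw [Real.sqrt_mul (by positivity), Real.sqrt_inv]
    rw [h1, mul_assoc, ← Real.exp_add]
    have hs : 0 < √(1 - 2 * a) := Real.sqrt_pos.mpr hpos
    have h2 : -z ^ 2 / 2 + (a * z ^ 2 + b * z)
        = b ^ 2 / (2 * (1 - 2 * a)) + -(z - b / (1 - 2 * a)) ^ 2 / (2 * (1 - 2 * a)⁻¹) := by
      field_simp
      ring
    rw [h2, Real.exp_add]
    field_simp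
  constructor
  · rw [gaussStd, gaussianReal_of_var_ne_zero _ one_ne_zero,
      integrable_withDensity_iff_integrable_smul' (measurable_gaussianPDF 0 1)
        (ae_of_all _ fun _ => gaussianPDF_lt_top)]
    simp only [toReal_gaussianPDF, smul_eq_mul, key]
    exact (integrable_gaussianPDFReal _ _).const_mul _
  · rw [integral_gaussianReal_eq_integral_smul one_ne_zero]
    simp only [smul_eq_mul, key]
    rw [integral_const_mul, integral_gaussianPDFReal_eq_one _ hv, mul_one]

/-- The Mehler kernel: the density of a pair of standard Gaussians with correlation `r`
with respect to the product of the marginals. -/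
def mehler (r x z : ℝ) : ℝ :=
  (√(1 - r ^ 2))⁻¹ *
    Real.exp (-(r ^ 2 * x ^ 2 + r ^ 2 * z ^ 2 - 2 * r * x * z) / (2 * (1 - r ^ 2)))

theorem mehler_comm (r x z : ℝ) : mehler r x z = mehler r z x := by
  unfold mehler
  ring_nf

theorem mehler_pos {r : ℝ} (hr : r ^ 2 < 1) (x z : ℝ) : 0 < mehler r x z := by
  have : 0 < 1 - r ^ 2 := by linarith
  unfold mehler
  positivity

@[fun_prop]
theorem measurable_mehler (r : ℝ) : Measurable fun p : ℝ × ℝ => mehler r p.1 p.2 := by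
  unfold mehler
  fun_prop

theorem measurable_mehler_right (r x : ℝ) : Measurable (mehler r x) := by
  unfold mehler
  fun_prop

theorem integrable_and_integral_mehler_mul {r : ℝ} (hr : r ^ 2 < 1) (y z : ℝ) :
    Integrable (fun x => mehler r x y * mehler r x z) gaussStd ∧
    ∫ x, mehler r x y * mehler r x z ∂gaussStd = mehler (r ^ 2) y z := by
  have h1 : 0 < 1 - r ^ 2 := by linarith
  have h2 : 0 < 1 + r ^ 2 := by positivity
  have ha : -(r ^ 2 / (1 - r ^ 2)) < 1 / 2 := by
    have : 0 ≤ r ^ 2 / (1 - r ^ 2) := by positivity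
    linarith
  obtain ⟨hi, hv⟩ := integrable_and_integral_exp_quadratic ha (r * (y + z) / (1 - r ^ 2))
  have key : ∀ x, mehler r x y * mehler r x z =
      ((1 - r ^ 2)⁻¹ * Real.exp (-(r ^ 2 * (y ^ 2 + z ^ 2)) / (2 * (1 - r ^ 2)))) *
      Real.exp (-(r ^ 2 / (1 - r ^ 2)) * x ^ 2 + r * (y + z) / (1 - r ^ 2) * x) := by
    intro x
    unfold mehler
    rw [mul_mul_mul_comm, ← mul_inv, Real.mul_self_sqrt h1.le, ← Real.exp_add,
      mul_assoc (1 - r ^ 2)⁻¹, ← Real.exp_add]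
    congr 2
    field_simp
    ring
  simp only [key]
  refine ⟨hi.const_mul _, ?_⟩
  rw [integral_const_mul, hv]
  have h3 : 1 - 2 * -(r ^ 2 / (1 - r ^ 2)) = (1 + r ^ 2) / (1 - r ^ 2) := by
    field_simp
    ring
  have h4 : 1 - (r ^ 2) ^ 2 = (1 - r ^ 2) * (1 + r ^ 2) := by ring
  rw [h3, mehler, h4, Real.sqrt_div h2.le, Real.sqrt_mul h1.le, mul_mul_mul_comm, ← Real.exp_add]
  have hs1 : 0 < √(1 - r ^ 2) := Real.sqrt_pos.mpr h1
  have hs2 : 0 < √(1 + r ^ 2) := Real.sqrt_pos.mpr h2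
  congr 1
  · field_simp
    rw [Real.sq_sqrt h1.le]
  · congr 1
    field_simp
    ring

/-- The integral of the squared Mehler kernel (one plus the chi-square information). -/
theorem integrable_and_integral_mehler_diag {r : ℝ} (hr : r ^ 2 < 1) :
    Integrable (fun x => mehler (r ^ 2) x x) gaussStd ∧
    ∫ x, mehler (r ^ 2) x x ∂gaussStd = (1 - r ^ 2)⁻¹ := by
  have h1 : 0 < 1 - r ^ 2 := by linarith
  have h2 : 0 < 1 + r ^ 2 := by positivity
  have ha : r ^ 2 / (1 + r ^ 2) < 1 / 2 := by
    rw [div_lt_div_iff₀ h2 two_pos]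
    linarith
  obtain ⟨hi, hv⟩ := integrable_and_integral_exp_quadratic ha 0
  have h4 : 1 - (r ^ 2) ^ 2 = (1 - r ^ 2) * (1 + r ^ 2) := by ring
  have key : ∀ x, mehler (r ^ 2) x x = (√((1 - r ^ 2) * (1 + r ^ 2)))⁻¹ *
      Real.exp (r ^ 2 / (1 + r ^ 2) * x ^ 2 + 0 * x) := by
    intro x
    unfold mehler
    rw [h4]
    congr 2
    field_simp
    ring
  simp only [key]
  refine ⟨hi.const_mul _, ?_⟩
  rw [integral_const_mul, hv]
  have h3 : 1 - 2 * (r ^ 2 / (1 + r ^ 2)) = (1 - r ^ 2) / (1 + r ^ 2) := by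
    field_simp
    ring
  have hs1 : 0 < √(1 - r ^ 2) := Real.sqrt_pos.mpr h1
  have hs2 : 0 < √(1 + r ^ 2) := Real.sqrt_pos.mpr h2
  rw [h3, Real.sqrt_div h1.le, Real.sqrt_mul h1.le]
  norm_num
  field_simp
  rw [Real.sq_sqrt h1.le]

theorem gaussianReal_eq_withDensity_mehler {r : ℝ} (hr : r ^ 2 < 1) (x : ℝ) :
    gaussianReal (r * x) (Real.toNNReal (1 - r ^ 2))
      = gaussStd.withDensity fun z => ENNReal.ofReal (mehler r x z) := by
  have h1 : 0 < 1 - r ^ 2 := by linarith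
  have hv : Real.toNNReal (1 - r ^ 2) ≠ 0 := by simpa using hr
  rw [gaussStd, gaussianReal_of_var_ne_zero _ hv, gaussianReal_of_var_ne_zero _ one_ne_zero,
    ← withDensity_mul _ (measurable_gaussianPDF 0 1)
      (measurable_mehler_right r x).ennreal_ofReal]
  congr 1
  ext z
  simp only [gaussianPDF, Pi.mul_apply]
  rw [← ENNReal.ofReal_mul (gaussianPDFReal_nonneg _ _ _)]
  congr 1
  simp only [gaussianPDFReal, mehler, Real.coe_toNNReal _ h1.le, NNReal.coe_one, mul_one, sub_zero]
  rw [Real.sqrt_mul (by positivity), mul_mul_mul_comm, ← mul_inv, ← Real.exp_add]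
  congr 2
  field_simp
  ring

/-- Mixing the second coordinate with the first so that the correlation becomes `r`. -/
def correlate (r : ℝ) (p : ℝ × ℝ) : ℝ × ℝ := (p.1, r * p.1 + √(1 - r ^ 2) * p.2)

@[fun_prop]
theorem measurable_correlate (r : ℝ) : Measurable (correlate r) := by
  unfold correlate
  fun_prop

theorem map_correlate {r : ℝ} (hr : r ^ 2 < 1) :
    (gaussStd.prod gaussStd).map (correlate r)
      = (gaussStd.prod gaussStd).withDensity fun p => ENNReal.ofReal (mehler r p.1 p.2) := by
  have h1 : 0 < 1 - r ^ 2 := by linarith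
  have hm : Measurable fun p : ℝ × ℝ => ENNReal.ofReal (mehler r p.1 p.2) :=
    (measurable_mehler r).ennreal_ofReal
  refine Measure.ext_of_lintegral _ fun f hf => ?_
  rw [lintegral_map hf (measurable_correlate r),
    lintegral_withDensity_eq_lintegral_mul _ hm hf,
    lintegral_prod (fun p => f (correlate r p)) (hf.comp (measurable_correlate r)).aemeasurable,
    lintegral_prod _ (hm.mul hf).aemeasurable]
  congr 1
  ext x
  have hmap : gaussStd.map (fun y => r * x + √(1 - r ^ 2) * y)
      = gaussStd.withDensity fun z => ENNReal.ofReal (mehler r x z) := by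
    rw [← gaussianReal_eq_withDensity_mehler hr,
      show (fun y => r * x + √(1 - r ^ 2) * y)
        = (fun y => r * x + y) ∘ (fun y => √(1 - r ^ 2) * y) from rfl,
      ← Measure.map_map (by fun_prop) (by fun_prop), gaussianReal_map_const_mul,
      gaussianReal_map_const_add]
    congr 1
    · ring
    · ext
      simp [Real.sq_sqrt h1.le, h1.le]
  have hfx : Measurable fun z => f (x, z) := hf.comp measurable_prodMk_left
  have e1 : ∫⁻ y, f (x, r * x + √(1 - r ^ 2) * y) ∂gaussStd
      = ∫⁻ z, f (x, z) ∂(gaussStd.map fun y => r * x + √(1 - r ^ 2) * y) := by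
    rw [lintegral_map hfx (by fun_prop)]
  simp only [correlate, Pi.mul_apply]
  rw [e1, hmap, lintegral_withDensity_eq_lintegral_mul _
    (measurable_mehler_right r x).ennreal_ofReal hfx]
  rfl

theorem integral_mul_sq_le {α : Type*} [MeasurableSpace α] {μ : Measure α} {f g : α → ℝ}
    (hf : MemLp f 2 μ) (hg : MemLp g 2 μ) :
    (∫ x, f x * g x ∂μ) ^ 2 ≤ (∫ x, f x ^ 2 ∂μ) * ∫ x, g x ^ 2 ∂μ := by
  have hfg : Integrable (fun x => f x * g x) μ := hf.integrable_mul hg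
  have key : ∀ t : ℝ, 0 ≤ (∫ x, g x ^ 2 ∂μ) * (t * t) + (2 * ∫ x, f x * g x ∂μ) * t
      + ∫ x, f x ^ 2 ∂μ := by
    intro t
    have h0 : 0 ≤ ∫ x, (f x + t * g x) ^ 2 ∂μ := integral_nonneg fun x => sq_nonneg _
    have h1 : ∫ x, (f x + t * g x) ^ 2 ∂μ
        = ∫ x, (t * t * g x ^ 2 + 2 * t * (f x * g x) + f x ^ 2) ∂μ := by
      congr 1
      ext x
      ring
    have h2 : Integrable (fun x => t * t * g x ^ 2 + 2 * t * (f x * g x)) μ :=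
      (hg.integrable_sq.const_mul _).add (hfg.const_mul _)
    rw [h1, integral_add h2 hf.integrable_sq,
      integral_add (hg.integrable_sq.const_mul _) (hfg.const_mul _), integral_const_mul,
      integral_const_mul] at h0
    linarith
  have := discrim_le_zero key
  unfold discrim at this
  nlinarith

theorem memLp_mehler {r : ℝ} (hr : r ^ 2 < 1) (x : ℝ) : MemLp (mehler r x) 2 gaussStd := by
  rw [memLp_two_iff_integrable_sq (measurable_mehler_right r x).aestronglyMeasurable]
  refine (integrable_and_integral_mehler_mul hr x x).1.congr (ae_of_all _ fun z => ?_)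
  simp only [mehler_comm r x z, sq]

theorem integral_mehler_sq {r : ℝ} (hr : r ^ 2 < 1) (x : ℝ) :
    ∫ z, mehler r x z ^ 2 ∂gaussStd = mehler (r ^ 2) x x := by
  rw [← (integrable_and_integral_mehler_mul hr x x).2]
  simp only [mehler_comm r x, sq]

theorem integral_mehler {r : ℝ} (hr : r ^ 2 < 1) (x : ℝ) :
    ∫ z, mehler r x z ∂gaussStd = 1 := by
  rw [integral_eq_lintegral_of_nonneg_ae (ae_of_all _ fun z => (mehler_pos hr x z).le)
    (measurable_mehler_right r x).aestronglyMeasurable]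
  have h : gaussianReal (r * x) (Real.toNNReal (1 - r ^ 2)) Set.univ = 1 := measure_univ
  rw [gaussianReal_eq_withDensity_mehler hr, withDensity_apply _ MeasurableSet.univ,
    setLIntegral_univ] at h
  rw [h, ENNReal.toReal_one]

/-- The conditional expectation operator of a pair of standard Gaussians with correlation `r`. -/
def mehlerOp (r : ℝ) (g : ℝ → ℝ) (x : ℝ) : ℝ := ∫ z, g z * mehler r x z ∂gaussStd

theorem measurable_mehlerOp (r : ℝ) {g : ℝ → ℝ} (hg : Measurable g) :
    Measurable (mehlerOp r g) := by
  have h : Measurable fun p : ℝ × ℝ => g p.2 * mehler r p.1 p.2 :=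
    (hg.comp measurable_snd).mul (measurable_mehler r)
  exact h.stronglyMeasurable.integral_prod_right'.measurable

theorem mehlerOp_sq_le {r : ℝ} (hr : r ^ 2 < 1) {g : ℝ → ℝ} (hg : MemLp g 2 gaussStd) (x : ℝ) :
    mehlerOp r g x ^ 2 ≤ (∫ z, g z ^ 2 ∂gaussStd) * mehler (r ^ 2) x x := by
  rw [← integral_mehler_sq hr]
  exact integral_mul_sq_le hg (memLp_mehler hr x)

theorem memLp_mehlerOp {r : ℝ} (hr : r ^ 2 < 1) {g : ℝ → ℝ} (hgm : Measurable g)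
    (hg : MemLp g 2 gaussStd) : MemLp (mehlerOp r g) 2 gaussStd := by
  rw [memLp_two_iff_integrable_sq (measurable_mehlerOp r hgm).aestronglyMeasurable]
  refine Integrable.mono' ((integrable_and_integral_mehler_diag hr).1.const_mul
    (∫ z, g z ^ 2 ∂gaussStd)) ((measurable_mehlerOp r hgm).pow_const 2).aestronglyMeasurable
    (ae_of_all _ fun x => ?_)
  rw [Real.norm_of_nonneg (sq_nonneg _)]
  exact mehlerOp_sq_le hr hg x

/-- The chi-square bound for the operator on centered functions. -/
theorem integral_mehlerOp_sq_le_of_centered {r : ℝ} (hr : r ^ 2 < 1) {g : ℝ → ℝ}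
    (hgm : Measurable g) (hg : MemLp g 2 gaussStd) (hg0 : ∫ z, g z ∂gaussStd = 0) :
    ∫ x, mehlerOp r g x ^ 2 ∂gaussStd
      ≤ (∫ z, g z ^ 2 ∂gaussStd) * (r ^ 2 * (1 - r ^ 2)⁻¹) := by
  have h1 : 0 < 1 - r ^ 2 := by linarith
  have hpt : ∀ x, mehlerOp r g x ^ 2
      ≤ (∫ z, g z ^ 2 ∂gaussStd) * (mehler (r ^ 2) x x - 1) := by
    intro x
    have hK := memLp_mehler hr x
    have hKi : Integrable (mehler r x) gaussStd := hK.integrable one_le_two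
    have hgi : Integrable g gaussStd := hg.integrable one_le_two
    have e1 : mehlerOp r g x = ∫ z, g z * (mehler r x z - 1) ∂gaussStd := by
      have hgK : Integrable (fun z => g z * mehler r x z) gaussStd := hg.integrable_mul hK
      simp only [mul_sub, mul_one]
      rw [integral_sub hgK hgi, hg0, sub_zero, mehlerOp]
    have e2 : ∫ z, (mehler r x z - 1) ^ 2 ∂gaussStd = mehler (r ^ 2) x x - 1 := by
      have : ∀ z, (mehler r x z - 1) ^ 2 = mehler r x z ^ 2 - 2 * mehler r x z + 1 :=
        fun z => by ring
      have h2 : Integrable (fun z => mehler r x z ^ 2 - 2 * mehler r x z) gaussStd :=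
        hK.integrable_sq.sub (hKi.const_mul 2)
      simp only [this]
      rw [integral_add h2 (integrable_const 1),
        integral_sub hK.integrable_sq (hKi.const_mul 2), integral_const_mul, integral_mehler hr,
        integral_mehler_sq hr]
      simp
      ring
    rw [e1, ← e2]
    exact integral_mul_sq_le hg (hK.sub (memLp_const 1))
  obtain ⟨hi, hv⟩ := integrable_and_integral_mehler_diag hr
  refine (integral_mono (memLp_mehlerOp hr hgm hg).integrable_sq
    ((hi.sub (integrable_const 1)).const_mul _) hpt).trans_eq ?_
  simp only [Pi.sub_apply]
  rw [integral_const_mul, integral_sub hi (integrable_const 1), hv]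
  congr 1
  simp
  field_simp
  ring

/-- Self-adjointness and the semigroup law: `‖T_r g‖² = ⟨g, T_{r²} g⟩`. -/
theorem integral_mehlerOp_sq {r : ℝ} (hr : r ^ 2 < 1) {g : ℝ → ℝ} (hgm : Measurable g)
    (hg : MemLp g 2 gaussStd) :
    ∫ x, mehlerOp r g x ^ 2 ∂gaussStd = ∫ y, g y * mehlerOp (r ^ 2) g y ∂gaussStd := by
  let F : ℝ × ℝ × ℝ → ℝ := fun p =>
    (g p.2.1 * mehler r p.1 p.2.1) * (g p.2.2 * mehler r p.1 p.2.2)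
  have hFm : Measurable F := by
    unfold F mehler
    fun_prop
  have hgK : ∀ x, Integrable (fun z => g z * mehler r x z) gaussStd :=
    fun x => hg.integrable_mul (memLp_mehler hr x)
  have hFi : Integrable F (gaussStd.prod (gaussStd.prod gaussStd)) := by
    rw [integrable_prod_iff hFm.aestronglyMeasurable]
    refine ⟨ae_of_all _ fun x => (hgK x).mul_prod (hgK x), ?_⟩
    refine (memLp_mehlerOp hr hgm.abs hg.abs).integrable_sq.congr (ae_of_all _ fun x => ?_)
    simp only [F, norm_mul]
    rw [integral_prod_mul (fun z => ‖g z‖ * ‖mehler r x z‖) (fun z => ‖g z‖ * ‖mehler r x z‖),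
      ← sq]
    simp only [Real.norm_eq_abs, abs_of_pos (mehler_pos hr x _)]
    rfl
  have hin : ∀ p : ℝ × ℝ, ∫ x, F (x, p) ∂gaussStd = g p.1 * (g p.2 * mehler (r ^ 2) p.1 p.2) := by
    intro p
    rw [← (integrable_and_integral_mehler_mul hr p.1 p.2).2, ← integral_const_mul,
      ← integral_const_mul]
    congr 1
    ext x
    simp only [F]
    ring
  have hi2 : Integrable (fun p : ℝ × ℝ => g p.1 * (g p.2 * mehler (r ^ 2) p.1 p.2))
      (gaussStd.prod gaussStd) :=
    hFi.integral_prod_right.congr (ae_of_all _ hin)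
  calc ∫ x, mehlerOp r g x ^ 2 ∂gaussStd
      = ∫ x, ∫ p, F (x, p) ∂(gaussStd.prod gaussStd) ∂gaussStd := by
        congr 1
        ext x
        simp only [F]
        rw [integral_prod_mul (fun z => g z * mehler r x z) (fun z => g z * mehler r x z), sq]
        rfl
    _ = ∫ p, ∫ x, F (x, p) ∂gaussStd ∂(gaussStd.prod gaussStd) := integral_integral_swap hFi
    _ = ∫ p, g p.1 * (g p.2 * mehler (r ^ 2) p.1 p.2) ∂(gaussStd.prod gaussStd) := by
        simp only [hin]
    _ = ∫ y, g y * mehlerOp (r ^ 2) g y ∂gaussStd := by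
        rw [integral_prod _ hi2]
        simp only [integral_const_mul, mehlerOp]

/-- Gebelein's inequality: `T_r` contracts centered functions by the factor `|r|`. -/
theorem integral_mehlerOp_sq_le {r : ℝ} (hr : r ^ 2 < 1) {g : ℝ → ℝ} (hgm : Measurable g)
    (hg : MemLp g 2 gaussStd) (hg0 : ∫ z, g z ∂gaussStd = 0)
    (hg1 : ∫ z, g z ^ 2 ∂gaussStd = 1) :
    ∫ x, mehlerOp r g x ^ 2 ∂gaussStd ≤ r ^ 2 := by
  set Q : ℝ → ℝ := fun s => ∫ x, mehlerOp s g x ^ 2 ∂gaussStd with hQ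
  have hQ0 : ∀ s, 0 ≤ Q s := fun s => integral_nonneg fun x => sq_nonneg _
  have hstep : ∀ s : ℝ, s ^ 2 < 1 → Q s ^ 2 ≤ Q (s ^ 2) := by
    intro s hs
    have hs2 : (s ^ 2) ^ 2 < 1 := by nlinarith [sq_nonneg s]
    have h := integral_mul_sq_le hg (memLp_mehlerOp hs2 hgm hg)
    rwa [← integral_mehlerOp_sq hs hgm hg, hg1, one_mul] at h
  have hpow : ∀ k : ℕ, (r ^ 2 ^ k) ^ 2 ≤ r ^ 2 := by
    intro k
    rw [← pow_mul, mul_comm, pow_mul]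
    exact pow_le_of_le_one (sq_nonneg r) hr.le (by positivity)
  have hiter : ∀ k : ℕ, Q r ^ 2 ^ k ≤ Q (r ^ 2 ^ k) := by
    intro k
    induction k with
    | zero => simp
    | succ k ih =>
      calc Q r ^ 2 ^ (k + 1) = (Q r ^ 2 ^ k) ^ 2 := by rw [pow_succ, pow_mul]
        _ ≤ Q (r ^ 2 ^ k) ^ 2 := by gcongr
        _ ≤ Q ((r ^ 2 ^ k) ^ 2) := hstep _ ((hpow k).trans_lt hr)
        _ = Q (r ^ 2 ^ (k + 1)) := by rw [← pow_mul, pow_succ]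
  have hbound : ∀ k : ℕ, Q r ^ 2 ^ k ≤ (r ^ 2) ^ 2 ^ k * (1 - r ^ 2)⁻¹ := by
    intro k
    have h := integral_mehlerOp_sq_le_of_centered ((hpow k).trans_lt hr) hgm hg hg0
    rw [hg1, one_mul] at h
    refine (hiter k).trans (h.trans ?_)
    rw [← pow_mul, mul_comm (2 ^ k) 2, pow_mul]
    have h1 : 0 < 1 - r ^ 2 := by linarith
    have h2 : (r ^ 2) ^ 2 ^ k ≤ r ^ 2 := by
      have := hpow k
      rwa [← pow_mul, mul_comm, pow_mul] at this
    gcongr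
  by_contra! hlt
  rcases (sq_nonneg r).eq_or_lt with h0 | h0
  · have := hbound 0
    rw [← h0] at this hlt
    simp at this
    exact absurd this (not_le.mpr hlt)
  · have hq : 1 < Q r / r ^ 2 := (one_lt_div h0).mpr hlt
    obtain ⟨k, hk⟩ := pow_unbounded_of_one_lt ((1 - r ^ 2)⁻¹) hq
    have h3 := hbound k
    rw [← div_le_iff₀' (by positivity), ← div_pow] at h3
    have h4 : (Q r / r ^ 2) ^ k ≤ (Q r / r ^ 2) ^ 2 ^ k :=
      pow_le_pow_right₀ hq.le k.lt_two_pow_self.le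
    linarith

theorem integral_correlate {r : ℝ} (hr : r ^ 2 < 1) {F : ℝ × ℝ → ℝ} (hF : Measurable F) :
    ∫ p, F (correlate r p) ∂(gaussStd.prod gaussStd)
      = ∫ p, mehler r p.1 p.2 * F p ∂(gaussStd.prod gaussStd) := by
  rw [← integral_map (measurable_correlate r).aemeasurable hF.aestronglyMeasurable,
    map_correlate hr, integral_withDensity_eq_integral_toReal_smul
      (measurable_mehler r).ennreal_ofReal (ae_of_all _ fun _ => ENNReal.ofReal_lt_top)]
  simp only [smul_eq_mul, ENNReal.toReal_ofReal (mehler_pos hr _ _).le]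

theorem integral_correlate_mul_le {r : ℝ} (hr : r ^ 2 < 1) {f g : ℝ → ℝ} (hfm : Measurable f)
    (hgm : Measurable g) (hf : MemLp f 2 gaussStd) (hg : MemLp g 2 gaussStd)
    (hg0 : ∫ z, g z ∂gaussStd = 0) (hf1 : ∫ z, f z ^ 2 ∂gaussStd = 1)
    (hg1 : ∫ z, g z ^ 2 ∂gaussStd = 1) :
    ∫ p, f (correlate r p).1 * g (correlate r p).2 ∂(gaussStd.prod gaussStd) ≤ |r| := by
  rw [integral_correlate hr (F := fun p => f p.1 * g p.2)
    ((hfm.comp measurable_fst).mul (hgm.comp measurable_snd))]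
  by_cases hi : Integrable (fun p : ℝ × ℝ => mehler r p.1 p.2 * (f p.1 * g p.2))
      (gaussStd.prod gaussStd)
  · have e : ∫ p, mehler r p.1 p.2 * (f p.1 * g p.2) ∂(gaussStd.prod gaussStd)
        = ∫ x, f x * mehlerOp r g x ∂gaussStd := by
      rw [integral_prod _ hi]
      congr 1
      ext x
      rw [mehlerOp, ← integral_const_mul]
      congr 1
      ext z
      ring
    rw [e]
    have h := integral_mul_sq_le hf (memLp_mehlerOp hr hgm hg)
    rw [hf1, one_mul] at h
    exact (le_abs_self _).trans
      (sq_le_sq.mp (h.trans (integral_mehlerOp_sq_le hr hgm hg hg0 hg1)))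
  · rw [integral_undef hi]
    exact abs_nonneg r

theorem measurePreserving_rotation {a b : ℝ} (hab : a ^ 2 + b ^ 2 = 1) :
    MeasurePreserving (fun p : ℝ × ℝ => a * p.1 + b * p.2) (gaussStd.prod gaussStd) gaussStd := by
  refine ⟨by fun_prop, ?_⟩
  have hind : IndepFun (fun p : ℝ × ℝ => a * p.1) (fun p : ℝ × ℝ => b * p.2)
      (gaussStd.prod gaussStd) :=
    indepFun_prod (X := fun x => a * x) (Y := fun y => b * y) (by fun_prop) (by fun_prop)
  have h1 : (gaussStd.prod gaussStd).map (fun p : ℝ × ℝ => a * p.1)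
      = gaussianReal (a * 0) (.mk (a ^ 2) (sq_nonneg a) * 1) := by
    conv_rhs => rw [← gaussianReal_map_const_mul,
      ← show (gaussStd.prod gaussStd).map Prod.fst = gaussianReal 0 1 from
        measurePreserving_fst.map_eq,
      Measure.map_map (by fun_prop) (by fun_prop)]
    rfl
  have h2 : (gaussStd.prod gaussStd).map (fun p : ℝ × ℝ => b * p.2)
      = gaussianReal (b * 0) (.mk (b ^ 2) (sq_nonneg b) * 1) := by
    conv_rhs => rw [← gaussianReal_map_const_mul,
      ← show (gaussStd.prod gaussStd).map Prod.snd = gaussianReal 0 1 from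
        measurePreserving_snd.map_eq,
      Measure.map_map (by fun_prop) (by fun_prop)]
    rfl
  have h := gaussianReal_add_gaussianReal_of_indepFun hind h1 h2
  refine h.trans ?_
  rw [gaussStd]
  congr 1
  · ring
  · ext
    simpa using hab

theorem measurePreserving_correlate_snd {r : ℝ} (hr : r ^ 2 < 1) :
    MeasurePreserving (fun p => (correlate r p).2) (gaussStd.prod gaussStd) gaussStd :=
  measurePreserving_rotation (by rw [Real.sq_sqrt (by linarith)]; ring)

theorem integral_comp_measurePreserving {α β : Type*} [MeasurableSpace α] [MeasurableSpace β]
    {μ : Measure α} {ν : Measure β} {φ : α → β} (h : MeasurePreserving φ μ ν) {F : β → ℝ}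
    (hF : Measurable F) : ∫ x, F (φ x) ∂μ = ∫ y, F y ∂ν := by
  rw [← h.map_eq, integral_map h.measurable.aemeasurable hF.aestronglyMeasurable]

theorem integral_gaussStd_id : ∫ x, x ∂gaussStd = 0 := integral_id_gaussianReal

theorem memLp_gaussStd_id : MemLp (fun x : ℝ => x) 2 gaussStd :=
  memLp_id_gaussianReal 2

theorem integral_gaussStd_sq : ∫ x, x ^ 2 ∂gaussStd = 1 := by
  have h : Var[fun x => x; gaussStd] = ((1 : NNReal) : ℝ) := variance_fun_id_gaussianReal
  rw [variance_of_integral_eq_zero aemeasurable_id' integral_gaussStd_id] at h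
  simpa using h

theorem integral_gaussStd_prod_quadratic (a b c d : ℝ) :
    Integrable (fun p : ℝ × ℝ => a + b * p.1 ^ 2 + c * p.2 ^ 2 + d * (p.1 * p.2))
      (gaussStd.prod gaussStd) ∧
    ∫ p : ℝ × ℝ, (a + b * p.1 ^ 2 + c * p.2 ^ 2 + d * (p.1 * p.2)) ∂(gaussStd.prod gaussStd)
      = a + b + c := by
  have hx : Integrable (fun x : ℝ => x) gaussStd := memLp_gaussStd_id.integrable one_le_two
  have hx2 : Integrable (fun x : ℝ => x ^ 2) gaussStd := memLp_gaussStd_id.integrable_sq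
  have h1 : Integrable (fun p : ℝ × ℝ => b * p.1 ^ 2) (gaussStd.prod gaussStd) :=
    (hx2.comp_fst gaussStd).const_mul b
  have h2 : Integrable (fun p : ℝ × ℝ => c * p.2 ^ 2) (gaussStd.prod gaussStd) :=
    (hx2.comp_snd gaussStd).const_mul c
  have h3 : Integrable (fun p : ℝ × ℝ => d * (p.1 * p.2)) (gaussStd.prod gaussStd) :=
    (hx.mul_prod hx).const_mul d
  have h4 : Integrable (fun p : ℝ × ℝ => a + b * p.1 ^ 2) (gaussStd.prod gaussStd) :=
    (integrable_const a).add h1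
  have h5 : Integrable (fun p : ℝ × ℝ => a + b * p.1 ^ 2 + c * p.2 ^ 2)
      (gaussStd.prod gaussStd) := h4.add h2
  refine ⟨h5.add h3, ?_⟩
  rw [integral_add h5 h3, integral_add h4 h2, integral_add (integrable_const a) h1,
    integral_const_mul, integral_const_mul, integral_const_mul,
    integral_comp_measurePreserving measurePreserving_fst (F := fun x => x ^ 2) (by fun_prop),
    integral_comp_measurePreserving measurePreserving_snd (F := fun x => x ^ 2) (by fun_prop),
    integral_prod_mul (fun x : ℝ => x) (fun x : ℝ => x), integral_gaussStd_sq,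
    integral_gaussStd_id]
  simp

section GaussianPair

variable {Ω : Type*} [MeasurableSpace Ω] {μ : Measure Ω} {P : Ω → ℝ × ℝ}
  {mU sU mV sV r : ℝ}

/-- The maximal correlation of a Gaussian pair is the absolute value of its correlation. -/
theorem rhoMC_gaussian (hP : MeasurePreserving P μ (gaussStd.prod gaussStd)) (hr : r ^ 2 < 1)
    (hsU : sU ≠ 0) (hsV : sV ≠ 0) :
    rhoMC μ (fun ω => mU + sU * (P ω).1) (fun ω => mV + sV * (correlate r (P ω)).2) = |r| := by
  have hU : MeasurePreserving (fun ω => (P ω).1) μ gaussStd := measurePreserving_fst.comp hP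
  have hV : MeasurePreserving (fun ω => (correlate r (P ω)).2) μ gaussStd :=
    (measurePreserving_correlate_snd hr).comp hP
  have hub : ∀ q ∈ { q : ℝ | ∃ f g : ℝ → ℝ, Measurable f ∧ Measurable g ∧
      (∫ ω, f (mU + sU * (P ω).1) ∂μ) = 0 ∧
      (∫ ω, g (mV + sV * (correlate r (P ω)).2) ∂μ) = 0 ∧
      (∫ ω, (f (mU + sU * (P ω).1)) ^ 2 ∂μ) = 1 ∧
      (∫ ω, (g (mV + sV * (correlate r (P ω)).2)) ^ 2 ∂μ) = 1 ∧
      q = ∫ ω, f (mU + sU * (P ω).1) * g (mV + sV * (correlate r (P ω)).2) ∂μ }, q ≤ |r| := by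
    rintro q ⟨f, g, hf, hg, -, hg0, hf1, hg1, rfl⟩
    have hfm : Measurable fun x => f (mU + sU * x) := hf.comp (by fun_prop)
    have hgm : Measurable fun x => g (mV + sV * x) := hg.comp (by fun_prop)
    rw [integral_comp_measurePreserving hV hgm] at hg0
    rw [integral_comp_measurePreserving hU (hfm.pow_const 2)] at hf1
    rw [integral_comp_measurePreserving hV (hgm.pow_const 2)] at hg1
    have hf2 : MemLp (fun x => f (mU + sU * x)) 2 gaussStd :=
      (memLp_two_iff_integrable_sq hfm.aestronglyMeasurable).mpr
        (.of_integral_ne_zero (by rw [hf1]; exact one_ne_zero))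
    have hg2 : MemLp (fun x => g (mV + sV * x)) 2 gaussStd :=
      (memLp_two_iff_integrable_sq hgm.aestronglyMeasurable).mpr
        (.of_integral_ne_zero (by rw [hg1]; exact one_ne_zero))
    rw [integral_comp_measurePreserving hP
      (F := fun p => f (mU + sU * p.1) * g (mV + sV * (correlate r p).2))
      ((hfm.comp measurable_fst).mul (hgm.comp (measurable_correlate r).snd))]
    exact integral_correlate_mul_le hr hfm hgm hf2 hg2 hg0 hf1 hg1
  obtain ⟨c, hc1, hcr⟩ : ∃ c : ℝ, c ^ 2 = 1 ∧ c * r = |r| := by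
    rcases le_total 0 r with h | h
    · exact ⟨1, by norm_num, by rw [abs_of_nonneg h, one_mul]⟩
    · exact ⟨-1, by norm_num, by rw [abs_of_nonpos h, neg_one_mul]⟩
  have hmem : |r| ∈ { q : ℝ | ∃ f g : ℝ → ℝ, Measurable f ∧ Measurable g ∧
      (∫ ω, f (mU + sU * (P ω).1) ∂μ) = 0 ∧
      (∫ ω, g (mV + sV * (correlate r (P ω)).2) ∂μ) = 0 ∧
      (∫ ω, (f (mU + sU * (P ω).1)) ^ 2 ∂μ) = 1 ∧
      (∫ ω, (g (mV + sV * (correlate r (P ω)).2)) ^ 2 ∂μ) = 1 ∧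
      q = ∫ ω, f (mU + sU * (P ω).1) * g (mV + sV * (correlate r (P ω)).2) ∂μ } := by
    refine ⟨fun u => (u - mU) / sU, fun v => c * ((v - mV) / sV), by fun_prop, by fun_prop, ?_⟩
    have eU : ∀ x, (mU + sU * x - mU) / sU = x := fun x => by field_simp; ring
    have eV : ∀ x, (mV + sV * x - mV) / sV = x := fun x => by field_simp; ring
    simp only [eU, eV, mul_pow, hc1, one_mul, integral_const_mul]
    rw [integral_comp_measurePreserving hU measurable_id',
      integral_comp_measurePreserving hV measurable_id',
      integral_comp_measurePreserving hU (F := fun x => x ^ 2) (by fun_prop),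
      integral_comp_measurePreserving hV (F := fun x => x ^ 2) (by fun_prop),
      integral_gaussStd_id, integral_gaussStd_sq, mul_zero,
      integral_comp_measurePreserving hP (F := fun p => p.1 * (c * (correlate r p).2))
        (by fun_prop)]
    refine ⟨rfl, rfl, rfl, rfl, ?_⟩
    have h := (integral_gaussStd_prod_quadratic 0 (c * r) 0 (c * √(1 - r ^ 2))).2
    rw [← hcr]
    refine (h.trans (by ring)).symm.trans ?_
    congr 1
    ext p
    simp only [correlate]
    ring
  exact le_antisymm (csSup_le ⟨_, hmem⟩ hub) (le_csSup ⟨_, hub⟩ hmem)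

theorem log_mehler_correlate (hr : r ^ 2 < 1) (p : ℝ × ℝ) :
    Real.log (mehler r (correlate r p).1 (correlate r p).2)
      = -(1 / 2) * Real.log (1 - r ^ 2) + r ^ 2 / 2 * p.1 ^ 2 + -(r ^ 2 / 2) * p.2 ^ 2
        + r * √(1 - r ^ 2) * (p.1 * p.2) := by
  have h1 : 0 < 1 - r ^ 2 := by linarith
  have hs : 0 < √(1 - r ^ 2) := Real.sqrt_pos.mpr h1
  have hs2 : √(1 - r ^ 2) ^ 2 = 1 - r ^ 2 := Real.sq_sqrt h1.le
  simp only [mehler, correlate]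
  rw [Real.log_mul (by positivity) (Real.exp_ne_zero _), Real.log_inv, Real.log_exp,
    Real.log_sqrt h1.le]
  generalize √(1 - r ^ 2) = s at *
  rw [← hs2]
  have hr2 : r ^ 2 = 1 - s ^ 2 := by linarith
  field_simp
  ring_nf
  have hr4 : r ^ 4 = (1 - s ^ 2) ^ 2 := by rw [← hr2]; ring
  have hr3 : r ^ 3 = r * (1 - s ^ 2) := by rw [← hr2]; ring
  rw [hr4, hr3, hr2]
  ring

/-- The mutual information of a Gaussian pair with correlation `r`. -/
theorem miE_gaussian (hP : MeasurePreserving P μ (gaussStd.prod gaussStd)) (hr : r ^ 2 < 1)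
    (hsU : sU ≠ 0) (hsV : sV ≠ 0) :
    miE μ (fun ω => mU + sU * (P ω).1) (fun ω => mV + sV * (correlate r (P ω)).2)
      = ((-(1 / 2) * Real.logb 2 (1 - r ^ 2) : ℝ) : EReal) := by
  let e : ℝ × ℝ → ℝ × ℝ := Prod.map (fun x => mU + sU * x) (fun x => mV + sV * x)
  let ψ : ℝ × ℝ → ℝ × ℝ := Prod.map (fun u => (u - mU) / sU) (fun v => (v - mV) / sV)
  have he : Measurable e := by unfold e; fun_prop
  have hψ : Measurable ψ := by unfold ψ; fun_prop
  have hψe : ∀ p, ψ (e p) = p := by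
    intro p
    ext
    · simp only [ψ, e, Prod.map_fst]; field_simp; ring
    · simp only [ψ, e, Prod.map_snd]; field_simp; ring
  have hU : MeasurePreserving (fun ω => (P ω).1) μ gaussStd := measurePreserving_fst.comp hP
  have hV : MeasurePreserving (fun ω => (correlate r (P ω)).2) μ gaussStd :=
    (measurePreserving_correlate_snd hr).comp hP
  have hprod : (μ.map fun ω => mU + sU * (P ω).1).prod
      (μ.map fun ω => mV + sV * (correlate r (P ω)).2) = (gaussStd.prod gaussStd).map e := by
    rw [← Measure.map_prod_map _ _ (by fun_prop) (by fun_prop)]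
    congr 1
    · conv_rhs => rw [← hU.map_eq, Measure.map_map (by fun_prop) hU.measurable]
      rfl
    · conv_rhs => rw [← hV.map_eq, Measure.map_map (by fun_prop) hV.measurable]
      rfl
  have hjoint : (μ.map fun ω => (mU + sU * (P ω).1, mV + sV * (correlate r (P ω)).2))
      = ((gaussStd.prod gaussStd).map (correlate r)).map e := by
    rw [← hP.map_eq, Measure.map_map (measurable_correlate r) hP.measurable,
      Measure.map_map he ((measurable_correlate r).comp hP.measurable)]
    rfl
  have hKm : Measurable fun p : ℝ × ℝ => mehler r (ψ p).1 (ψ p).2 :=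
    (measurable_mehler r).comp hψ
  have hdens : ((gaussStd.prod gaussStd).map (correlate r)).map e
      = ((gaussStd.prod gaussStd).map e).withDensity
        fun p => ENNReal.ofReal (mehler r (ψ p).1 (ψ p).2) := by
    rw [map_correlate hr]
    ext s hs
    rw [Measure.map_apply he hs, withDensity_apply _ (he hs), withDensity_apply _ hs,
      setLIntegral_map hs hKm.ennreal_ofReal he]
    simp only [hψe]
  rw [miE, hprod, hjoint]
  set J := ((gaussStd.prod gaussStd).map (correlate r)).map e with hJ
  set M := (gaussStd.prod gaussStd).map e with hM
  have : IsProbabilityMeasure M := Measure.isProbabilityMeasure_map he.aemeasurable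
  have hac : J ≪ M := by
    rw [hdens]
    exact withDensity_absolutelyContinuous _ _
  have hllr : llr J M =ᵐ[J] fun p => Real.log (mehler r (ψ p).1 (ψ p).2) := by
    refine hac.ae_le ?_
    have h := Measure.rnDeriv_withDensity M hKm.ennreal_ofReal
    rw [← hdens] at h
    filter_upwards [h] with p hp
    rw [llr, hp, ENNReal.toReal_ofReal (mehler_pos hr _ _).le]
  have hlm : Measurable fun p : ℝ × ℝ => Real.log (mehler r (ψ p).1 (ψ p).2) := hKm.log
  have hlm' : Measurable fun p : ℝ × ℝ => Real.log (mehler r (ψ (e p)).1 (ψ (e p)).2) :=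
    hlm.comp he
  obtain ⟨hqi, hqv⟩ := integral_gaussStd_prod_quadratic
    (-(1 / 2) * Real.log (1 - r ^ 2)) (r ^ 2 / 2) (-(r ^ 2 / 2)) (r * √(1 - r ^ 2))
  have hint : Integrable (llr J M) J := by
    rw [integrable_congr hllr, hJ, integrable_map_measure hlm.aestronglyMeasurable he.aemeasurable,
      integrable_map_measure (hlm.comp he).aestronglyMeasurable
        (measurable_correlate r).aemeasurable]
    simp only [Function.comp_def, hψe, log_mehler_correlate hr]
    exact hqi
  have hval : ∫ p, llr J M p ∂J = -(1 / 2) * Real.log (1 - r ^ 2) := by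
    rw [integral_congr_ae hllr, hJ, integral_map he.aemeasurable hlm.aestronglyMeasurable,
      integral_map (measurable_correlate r).aemeasurable hlm'.aestronglyMeasurable]
    simp only [hψe, log_mehler_correlate hr]
    rw [hqv]
    ring
  rw [if_pos ⟨hac, hint⟩, hval, Real.logb, mul_div_assoc]

end GaussianPair

theorem rhoMC_Xg_Zg_sq {mX mY sX sY ρ : ℝ} (hsX : 0 < sX) (hsY : 0 < sY) (hρ1 : ρ ^ 2 < 1)
    (γ : ℝ) :
    rhoMC μ3 (Xg mX sX) (Zg mY sY ρ γ) ^ 2 = ρ ^ 2 * sY ^ 2 / (sY ^ 2 + γ ^ 2) := by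
  have hv : 0 < sY ^ 2 + γ ^ 2 := by positivity
  set σ := √(sY ^ 2 + γ ^ 2) with hσ
  have hσ0 : 0 < σ := Real.sqrt_pos.mpr hv
  have hσ2 : σ ^ 2 = sY ^ 2 + γ ^ 2 := Real.sq_sqrt hv.le
  set r := ρ * sY / σ with hrdef
  have hr2 : r ^ 2 = ρ ^ 2 * sY ^ 2 / (sY ^ 2 + γ ^ 2) := by
    rw [hrdef, div_pow, mul_pow, hσ2]
  have hr : r ^ 2 < 1 := by
    rw [hr2, div_lt_one hv]
    nlinarith [sq_nonneg γ, sq_pos_of_pos hsY]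
  set t := √(1 - r ^ 2) with ht
  have ht2 : t ^ 2 = 1 - r ^ 2 := Real.sq_sqrt (by linarith)
  have ht0 : 0 < t := Real.sqrt_pos.mpr (by linarith)
  have hs2 : √(1 - ρ ^ 2) ^ 2 = 1 - ρ ^ 2 := Real.sq_sqrt (by linarith)
  have hab : (sY * √(1 - ρ ^ 2) / (σ * t)) ^ 2
      + (γ / (σ * t)) ^ 2 = 1 := by
    have hne : σ ^ 2 * (1 - r ^ 2) = sY ^ 2 * (1 - ρ ^ 2) + γ ^ 2 := by
      rw [hr2, hσ2]
      field_simp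
      ring
    rw [div_pow, div_pow, mul_pow, mul_pow, ht2, hs2, hne, ← add_div, div_self]
    have := sub_pos.mpr hρ1
    positivity
  have hP : MeasurePreserving (fun ω : ℝ × ℝ × ℝ => (ω.1,
      sY * √(1 - ρ ^ 2) / (σ * t) * ω.2.1
        + γ / (σ * t) * ω.2.2)) μ3 (gaussStd.prod gaussStd) :=
    (MeasurePreserving.id gaussStd).prod (measurePreserving_rotation hab)
  have hZ : Zg mY sY ρ γ = fun ω => mY + σ * (correlate r (ω.1,
      sY * √(1 - ρ ^ 2) / (σ * t) * ω.2.1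
        + γ / (σ * t) * ω.2.2)).2 := by
    ext ω
    have hrσ : σ * r = ρ * sY := by
      rw [hrdef]
      field_simp
    simp only [Zg, Yg, correlate, ← ht]
    field_simp
    linear_combination -ω.1 * hrσ
  have h := rhoMC_gaussian (mU := mX) (mV := mY) hP hr hsX.ne' hσ0.ne'
  rw [← hZ] at h
  rw [← hr2, ← sq_abs r, ← h]
  rfl

theorem miE_Yg_Zg {mY sY ρ γ : ℝ} (hsY : 0 < sY) (hρ1 : ρ ^ 2 < 1) (hγ : 0 < γ) :
    miE μ3 (Yg mY sY ρ) (Zg mY sY ρ γ)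
      = ((-(1 / 2) * Real.logb 2 (1 - sY ^ 2 / (sY ^ 2 + γ ^ 2)) : ℝ) : EReal) := by
  have hv : 0 < sY ^ 2 + γ ^ 2 := by positivity
  set σ := √(sY ^ 2 + γ ^ 2) with hσ
  have hσ0 : 0 < σ := Real.sqrt_pos.mpr hv
  have hσ2 : σ ^ 2 = sY ^ 2 + γ ^ 2 := Real.sq_sqrt hv.le
  have hr2 : (sY / σ) ^ 2 = sY ^ 2 / (sY ^ 2 + γ ^ 2) := by rw [div_pow, hσ2]
  have hr : (sY / σ) ^ 2 < 1 := by
    rw [hr2, div_lt_one hv]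
    linarith [sq_pos_of_pos hγ]
  have ht : √(1 - (sY / σ) ^ 2) = γ / σ := by
    rw [Real.sqrt_eq_iff_mul_self_eq (by linarith) (by positivity), hr2, ← sq, div_pow, hσ2]
    field_simp
    ring
  have hab : ρ ^ 2 + √(1 - ρ ^ 2) ^ 2 = 1 := by
    rw [Real.sq_sqrt (by linarith)]
    ring
  have hP : MeasurePreserving (fun ω : ℝ × ℝ × ℝ => (ρ * ω.1 + √(1 - ρ ^ 2) * ω.2.1, ω.2.2))
      μ3 (gaussStd.prod gaussStd) :=
    ((measurePreserving_rotation hab).prod (MeasurePreserving.id gaussStd)).comp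
      ((measurePreserving_prodAssoc gaussStd gaussStd gaussStd).symm)
  have hZ : Zg mY sY ρ γ = fun ω => mY + σ * (correlate (sY / σ)
      (ρ * ω.1 + √(1 - ρ ^ 2) * ω.2.1, ω.2.2)).2 := by
    ext ω
    simp only [Zg, Yg, correlate, ht]
    field_simp
    ring
  have h := miE_gaussian (mU := mY) (mV := mY) hP hr hsY.ne' hσ0.ne'
  rw [← hZ, hr2] at h
  exact h

theorem pos_of_rhoMC_sq_lt {mX mY sX sY ρ γ : ℝ} (hsX : 0 < sX) (hsY : 0 < sY)
    (hρ1 : ρ ^ 2 < 1) (hγ : 0 ≤ γ)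
    (h : rhoMC μ3 (Xg mX sX) (Zg mY sY ρ γ) ^ 2 < ρ ^ 2) : 0 < γ := by
  refine hγ.lt_of_ne ?_
  rintro rfl
  rw [rhoMC_Xg_Zg_sq hsX hsY hρ1] at h
  field_simp at h
  simp at h

theorem γhat_pos {sY ρ ε : ℝ} (hsY : 0 < sY) (hε : 0 < ε) (hερ : ε < ρ ^ 2) :
    0 < γhat sY ρ ε := by
  have := sub_pos.mpr hερ
  exact Real.sqrt_pos.mpr (by positivity)

theorem sq_add_γhat_sq {sY ρ ε : ℝ} (hε : 0 < ε) (hερ : ε < ρ ^ 2) :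
    sY ^ 2 + γhat sY ρ ε ^ 2 = sY ^ 2 * ρ ^ 2 / ε := by
  have := sub_pos.mpr hερ
  rw [γhat, Real.sq_sqrt (by positivity)]
  field_simp
  ring

theorem rhoMC_γhat_sq {mX mY sX sY ρ ε : ℝ} (hsX : 0 < sX) (hsY : 0 < sY) (hρ1 : ρ ^ 2 < 1)
    (hε : 0 < ε) (hερ : ε < ρ ^ 2) :
    rhoMC μ3 (Xg mX sX) (Zg mY sY ρ (γhat sY ρ ε)) ^ 2 = ε := by
  have hρ : ρ ≠ 0 := by
    rintro rfl
    linarith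
  rw [rhoMC_Xg_Zg_sq hsX hsY hρ1, sq_add_γhat_sq hε hερ, mul_comm (ρ ^ 2)]
  field_simp

theorem neg_half_logb_eq {ρ ε : ℝ} (hρ0 : 0 < ρ ^ 2) :
    -(1 / 2) * Real.logb 2 (1 - ε / ρ ^ 2) = 1 / 2 * Real.logb 2 (ρ ^ 2 / (ρ ^ 2 - ε)) := by
  have h : 1 - ε / ρ ^ 2 = (ρ ^ 2 / (ρ ^ 2 - ε))⁻¹ := by
    rw [inv_div, sub_div, div_self hρ0.ne']
  rw [h, Real.logb_inv]
  ring

theorem miE_γhat {mY sY ρ ε : ℝ} (hsY : 0 < sY) (hρ1 : ρ ^ 2 < 1)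
    (hε : 0 < ε) (hερ : ε < ρ ^ 2) :
    miE μ3 (Yg mY sY ρ) (Zg mY sY ρ (γhat sY ρ ε))
      = ((1 / 2 * Real.logb 2 (ρ ^ 2 / (ρ ^ 2 - ε)) : ℝ) : EReal) := by
  have hρ0 := hε.trans hερ
  have e : sY ^ 2 / (sY ^ 2 * ρ ^ 2 / ε) = ε / ρ ^ 2 := by field_simp
  rw [miE_Yg_Zg hsY hρ1 (γhat_pos hsY hε hερ), sq_add_γhat_sq hε hερ, e, neg_half_logb_eq hρ0]

theorem ghG_eq_of_pos {mX mY sX sY ρ ε : ℝ} (hsX : 0 < sX) (hsY : 0 < sY) (hρ1 : ρ ^ 2 < 1)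
    (hε : 0 < ε) (hερ : ε < ρ ^ 2) :
    ghG mX mY sX sY ρ ε = 1 / 2 * Real.logb 2 (ρ ^ 2 / (ρ ^ 2 - ε)) := by
  have hρ0 := hε.trans hερ
  refine IsGreatest.csSup_eq ⟨⟨γhat sY ρ ε, (γhat_pos hsY hε hερ).le,
    (rhoMC_γhat_sq hsX hsY hρ1 hε hερ).le, (miE_γhat hsY hρ1 hε hερ).symm⟩, ?_⟩
  rintro q ⟨γ, hγ, hle, hq⟩
  have hγ0 := pos_of_rhoMC_sq_lt hsX hsY hρ1 hγ (hle.trans_lt hερ)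
  rw [miE_Yg_Zg hsY hρ1 hγ0, EReal.coe_eq_coe_iff] at hq
  rw [rhoMC_Xg_Zg_sq hsX hsY hρ1] at hle
  rw [hq, ← neg_half_logb_eq hρ0]
  have hle' : sY ^ 2 / (sY ^ 2 + γ ^ 2) ≤ ε / ρ ^ 2 := by
    rw [le_div_iff₀' hρ0, ← mul_div_assoc]
    exact hle
  have hpos : 0 < 1 - ε / ρ ^ 2 := sub_pos.mpr ((div_lt_one hρ0).mpr hερ)
  have hlog := Real.logb_le_logb_of_le one_lt_two hpos (sub_le_sub_left hle' 1)
  linarith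

/-- With zero leakage allowed no finite noise level is admissible. -/
theorem ghG_zero {mX mY sX sY ρ : ℝ} (hsX : 0 < sX) (hsY : 0 < sY) (hρ0 : 0 < ρ ^ 2)
    (hρ1 : ρ ^ 2 < 1) : ghG mX mY sX sY ρ 0 = 0 := by
  rw [ghG]
  refine (congrArg sSup (Set.eq_empty_of_forall_notMem ?_)).trans Real.sSup_empty
  rintro q ⟨γ, -, hle, -⟩
  rw [rhoMC_Xg_Zg_sq hsX hsY hρ1] at hle
  exact absurd hle (not_le.mpr (by positivity))

/-- Let `(X,Y)` be jointly Gaussian with positive variances and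
correlation coefficient `ρ`, `0 < ρ² < 1`.  Then for every `ε ∈ [0, ρ²)`,
`ĝ_ε(X;Y) = (1/2)·log(ρ²/(ρ²−ε))`; for `ε ∈ (0, ρ²)` the supremum is attained at
`γ² = ((ρ²−ε)/ε)·var(Y)`.  In particular `ĝ_0(X;Y) = 0`.  (Logarithms are base 2.) -/
theorem stmt19 (mX mY sX sY ρ : ℝ) (hsX : 0 < sX) (hsY : 0 < sY)
    (hρ0 : 0 < ρ ^ 2) (hρ1 : ρ ^ 2 < 1) :
    (∀ ε : ℝ, 0 ≤ ε → ε < ρ ^ 2 →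
      ghG mX mY sX sY ρ ε = 1 / 2 * Real.logb 2 (ρ ^ 2 / (ρ ^ 2 - ε))) ∧
    (∀ ε : ℝ, 0 < ε → ε < ρ ^ 2 →
      (rhoMC μ3 (Xg mX sX) (Zg mY sY ρ (γhat sY ρ ε))) ^ 2 ≤ ε ∧
      ((ghG mX mY sX sY ρ ε : ℝ) : EReal)
        = miE μ3 (Yg mY sY ρ) (Zg mY sY ρ (γhat sY ρ ε))) ∧
    ghG mX mY sX sY ρ 0 = 0 := by
  refine ⟨fun ε hε hερ => ?_, fun ε hε hερ => ?_, ghG_zero hsX hsY hρ0 hρ1⟩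
  · rcases hε.eq_or_lt with rfl | hε
    · rw [ghG_zero hsX hsY hρ0 hρ1, sub_zero, div_self hρ0.ne', Real.logb_one, mul_zero]
    · exact ghG_eq_of_pos hsX hsY hρ1 hε hερ
  · exact ⟨(rhoMC_γhat_sq hsX hsY hρ1 hε hερ).le, by
      rw [ghG_eq_of_pos hsX hsY hρ1 hε hερ, miE_γhat hsY hρ1 hε hερ]⟩

end GaussPrivacy
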